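/- arXiv:1811.05952 — 5 statements merged into one kernel-verified Lean document; each statement's English description precedes it below -/
import Mathlib

section
/- The set Ω_β = {(n1, n2, q) ∈ ℤ² × ℤ⁺ : q·(1 + ω·(p1² + p2²)) − β·√(p1² + p2²) = 0} is finite (possibly empty). -/
theorem Int.finite_setOf_mul_abs_le {c : ℝ} (hc : 0 < c) (B : ℝ) :
    {n : ℤ | c * |(n : ℝ)| ≤ B}.Finite := by
  refine (Set.finite_Icc (-⌈B / c⌉) ⌈B / c⌉).subset fun n hn => ?_
  have h : |(n : ℝ)| ≤ (⌈B / c⌉ : ℤ) := ((le_div_iff₀' hc).2 hn).trans (Int.le_ceil _)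
  rw [Set.mem_Icc, ← abs_le]
  exact_mod_cast h

/-- The set `Ω_β = {(n1, n2, q) ∈ ℤ² × ℤ⁺ :
q·(1 + ω·(p1² + p2²)) − β·√(p1² + p2²) = 0}` is finite (possibly empty),
where `p1 = k1·n1 + k2·n2` and `p2 = τ1·k1·n1 − τ2·k2·n2`. -/
theorem stmt_0 (ω β k1 k2 τ1 τ2 : ℝ) (hω : 0 < ω) (hβ : 0 < β)
    (hk1 : 0 < k1) (hk2 : 0 < k2) (hτ1 : 0 < τ1) (hτ2 : 0 < τ2) :
    {x : ℤ × ℤ × ℤ | 0 < x.2.2 ∧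
      (x.2.2 : ℝ) * (1 + ω * ((k1 * x.1 + k2 * x.2.1) ^ 2 +
          (τ1 * k1 * x.1 - τ2 * k2 * x.2.1) ^ 2)) -
        β * Real.sqrt ((k1 * x.1 + k2 * x.2.1) ^ 2 +
          (τ1 * k1 * x.1 - τ2 * k2 * x.2.1) ^ 2) = 0}.Finite := by
  have hc1 : 0 < (τ1 + τ2) * k1 := by positivity
  have hc2 : 0 < (τ1 + τ2) * k2 := by positivity
  refine ((Int.finite_setOf_mul_abs_le hc1 ((τ2 + 1) * (β / ω))).prod
    ((Int.finite_setOf_mul_abs_le hc2 ((τ1 + 1) * (β / ω))).prod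
      (Int.finite_setOf_mul_abs_le one_pos (β * (β / ω))))).subset ?_
  rintro ⟨n1, n2, q⟩ ⟨hq, h⟩
  dsimp only at hq h
  set p1 : ℝ := k1 * n1 + k2 * n2 with hp1
  set p2 : ℝ := τ1 * k1 * n1 - τ2 * k2 * n2 with hp2
  set s : ℝ := √(p1 ^ 2 + p2 ^ 2) with hs
  have hs0 : 0 ≤ s := Real.sqrt_nonneg _
  have hsq : s ^ 2 = p1 ^ 2 + p2 ^ 2 := Real.sq_sqrt (by positivity)
  rw [← hsq] at h
  have hq1 : (1 : ℝ) ≤ q := by exact_mod_cast hq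
  have hsM : s ≤ β / ω := by
    rw [le_div_iff₀ hω]
    by_contra! hlt
    have hspos : 0 < s := by
      by_contra! hle
      nlinarith
    nlinarith [mul_pos hspos (sub_pos.2 hlt),
      mul_nonneg (sub_nonneg.2 hq1) (by positivity : 0 ≤ 1 + ω * s ^ 2)]
  have h1 : |p1| ≤ β / ω := (Real.abs_le_sqrt (by nlinarith [sq_nonneg p2])).trans hsM
  have h2 : |p2| ≤ β / ω := (Real.abs_le_sqrt (by nlinarith [sq_nonneg p1])).trans hsM
  refine ⟨?_, ?_, ?_⟩ <;> simp only [Set.mem_ofPred_eq]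
  · calc (τ1 + τ2) * k1 * |(n1 : ℝ)| = |τ2 * p1 + p2| := by
          rw [← abs_of_pos hc1, ← abs_mul, hp1, hp2]
          ring_nf
      _ ≤ τ2 * |p1| + |p2| := by
          simpa only [abs_mul, abs_of_pos hτ2] using abs_add_le (τ2 * p1) p2
      _ ≤ (τ2 + 1) * (β / ω) := by nlinarith
  · calc (τ1 + τ2) * k2 * |(n2 : ℝ)| = |τ1 * p1 - p2| := by
          rw [← abs_of_pos hc2, ← abs_mul, hp1, hp2]
          ring_nf
      _ ≤ τ1 * |p1| + |p2| := by
          simpa only [abs_mul, abs_of_pos hτ1] using abs_sub (τ1 * p1) p2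
      _ ≤ (τ1 + 1) * (β / ω) := by nlinarith
  · have hqs : (q : ℝ) ≤ β * s := by
      nlinarith [mul_nonneg (zero_le_one.trans hq1) (by positivity : 0 ≤ ω * s ^ 2)]
    rw [one_mul, abs_of_nonneg (zero_le_one.trans hq1)]
    exact hqs.trans (by gcongr)
end

section
/- There exists a constant M > 0 such that for every (n1, n2, q) ∈ ℤ² × ℤ⁺ with (n1, n2, q) ∉ Ω_β, one has √(p1² + p2²) ≤ M·|q·(1 + ω·(p1² + p2²)) − β·√(p1² + p2²)|. -/
theorem Set.Finite.exists_le_mul_abs {ι : Type*} {s : Set ι} (hs : s.Finite) (f g : ι → ℝ) :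
    ∃ M : ℝ, 1 ≤ M ∧ ∀ x ∈ s, g x ≠ 0 → f x ≤ M * |g x| := by
  obtain ⟨B, hB⟩ := (hs.image fun x ↦ f x / |g x|).bddAbove
  refine ⟨max 1 B, le_max_left _ _, fun x hx hg ↦ ?_⟩
  rw [← div_le_iff₀ (abs_pos.2 hg)]
  exact (hB (Set.mem_image_of_mem _ hx)).trans (le_max_right _ _)

theorem exists_int_box {k1 k2 τ1 τ2 : ℝ} (hk1 : 0 < k1) (hk2 : 0 < k2) (hτ1 : 0 < τ1)
    (hτ2 : 0 < τ2) (R : ℝ) :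
    ∃ N : ℤ, ∀ n1 n2 : ℤ,
      √((k1 * n1 + k2 * n2) ^ 2 + (τ1 * k1 * n1 - τ2 * k2 * n2) ^ 2) ≤ R →
        |n1| ≤ N ∧ |n2| ≤ N := by
  obtain ⟨N, hN⟩ := exists_int_ge
    (max ((τ2 + 1) * R / ((τ1 + τ2) * k1)) ((τ1 + 1) * R / ((τ1 + τ2) * k2)))
  refine ⟨N, fun n1 n2 h ↦ ?_⟩
  have hp1 := (Real.abs_le_sqrt (le_add_of_nonneg_right (sq_nonneg _))).trans h
  have hp2 := (Real.abs_le_sqrt (le_add_of_nonneg_left (sq_nonneg _))).trans h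
  rw [abs_le] at hp1 hp2
  have hc1 : 0 < (τ1 + τ2) * k1 := by positivity
  have hc2 : 0 < (τ1 + τ2) * k2 := by positivity
  have h1 : |(n1 : ℝ)| ≤ (τ2 + 1) * R / ((τ1 + τ2) * k1) := by
    rw [le_div_iff₀ hc1, ← abs_of_pos hc1, ← abs_mul, abs_le]
    constructor <;> nlinarith
  have h2 : |(n2 : ℝ)| ≤ (τ1 + 1) * R / ((τ1 + τ2) * k2) := by
    rw [le_div_iff₀ hc2, ← abs_of_pos hc2, ← abs_mul, abs_le]
    constructor <;> nlinarith
  constructor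
  · exact_mod_cast h1.trans ((le_max_left _ _).trans hN)
  · exact_mod_cast h2.trans ((le_max_right _ _).trans hN)

/-- There exists a constant `M > 0` such that for every `(n1, n2, q) ∈ ℤ² × ℤ⁺`
with `(n1, n2, q) ∉ Ω_β`, one has
`√(p1² + p2²) ≤ M·|q·(1 + ω·(p1² + p2²)) − β·√(p1² + p2²)|`, where
`p1 = k1·n1 + k2·n2` and `p2 = τ1·k1·n1 − τ2·k2·n2`. -/
theorem stmt_9 (ω β k1 k2 τ1 τ2 : ℝ) (hω : 0 < ω) (hβ : 0 < β)
    (hk1 : 0 < k1) (hk2 : 0 < k2) (hτ1 : 0 < τ1) (hτ2 : 0 < τ2) :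
    ∃ M : ℝ, 0 < M ∧ ∀ n1 n2 q : ℤ, 0 < q →
      (q : ℝ) * (1 + ω * ((k1 * n1 + k2 * n2) ^ 2 +
          (τ1 * k1 * n1 - τ2 * k2 * n2) ^ 2)) -
        β * Real.sqrt ((k1 * n1 + k2 * n2) ^ 2 +
          (τ1 * k1 * n1 - τ2 * k2 * n2) ^ 2) ≠ 0 →
      Real.sqrt ((k1 * n1 + k2 * n2) ^ 2 + (τ1 * k1 * n1 - τ2 * k2 * n2) ^ 2) ≤
        M * |(q : ℝ) * (1 + ω * ((k1 * n1 + k2 * n2) ^ 2 +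
            (τ1 * k1 * n1 - τ2 * k2 * n2) ^ 2)) -
          β * Real.sqrt ((k1 * n1 + k2 * n2) ^ 2 +
            (τ1 * k1 * n1 - τ2 * k2 * n2) ^ 2)| := by
  obtain ⟨N, hN⟩ := exists_int_box hk1 hk2 hτ1 hτ2 ((β + 1) / ω)
  obtain ⟨Q, hQ⟩ := exists_int_ge ((β + 1) * ((β + 1) / ω))
  obtain ⟨M, hM1, hM⟩ := (((Set.finite_Icc (-N) N).prod
    ((Set.finite_Icc (-N) N).prod (Set.finite_Icc 0 Q)))).exists_le_mul_abs
    (fun x : ℤ × ℤ × ℤ ↦ √((k1 * x.1 + k2 * x.2.1) ^ 2 + (τ1 * k1 * x.1 - τ2 * k2 * x.2.1) ^ 2))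
    (fun x : ℤ × ℤ × ℤ ↦ (x.2.2 : ℝ) * (1 + ω * ((k1 * x.1 + k2 * x.2.1) ^ 2 +
      (τ1 * k1 * x.1 - τ2 * k2 * x.2.1) ^ 2)) -
      β * √((k1 * x.1 + k2 * x.2.1) ^ 2 + (τ1 * k1 * x.1 - τ2 * k2 * x.2.1) ^ 2))
  refine ⟨M, by linarith, fun n1 n2 q hq hne ↦ ?_⟩
  have hr := Real.sqrt_nonneg ((k1 * n1 + k2 * n2) ^ 2 + (τ1 * k1 * n1 - τ2 * k2 * n2) ^ 2)
  have hsq := Real.sq_sqrt (show 0 ≤ (k1 * n1 + k2 * n2) ^ 2 +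
    (τ1 * k1 * n1 - τ2 * k2 * n2) ^ 2 by positivity)
  by_cases hsmall : √((k1 * n1 + k2 * n2) ^ 2 + (τ1 * k1 * n1 - τ2 * k2 * n2) ^ 2) <
      (β + 1) / ω ∧ q ≤ Q
  · obtain ⟨h1, h2⟩ := hN n1 n2 hsmall.1.le
    exact hM (n1, n2, q) ⟨abs_le.1 h1, abs_le.1 h2, hq.le, hsmall.2⟩ hne
  · set r := √((k1 * n1 + k2 * n2) ^ 2 + (τ1 * k1 * n1 - τ2 * k2 * n2) ^ 2) with hr_def
    rw [← hsq]
    have hq1 : (1 : ℝ) ≤ q := by exact_mod_cast hq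
    have key : r ≤ (q : ℝ) * (1 + ω * r ^ 2) - β * r := by
      have hωr : 0 ≤ ω * r ^ 2 := by positivity
      rcases le_or_gt ((β + 1) / ω) r with h | h
      · rw [div_le_iff₀ hω] at h
        nlinarith [mul_le_mul_of_nonneg_right h hr,
          mul_le_mul_of_nonneg_right hq1 (add_nonneg zero_le_one hωr)]
      · have hQq : (Q : ℝ) < q := by
          exact_mod_cast not_le.1 fun hle ↦ hsmall ⟨h, hle⟩
        nlinarith [mul_le_mul_of_nonneg_left h.le (show 0 ≤ β + 1 by linarith),
          mul_nonneg (zero_le_one.trans hq1) hωr]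
    calc r ≤ |(q : ℝ) * (1 + ω * r ^ 2) - β * r| := key.trans (le_abs_self _)
      _ ≤ M * |(q : ℝ) * (1 + ω * r ^ 2) - β * r| := le_mul_of_one_le_left (abs_nonneg _) hM1
end

section
/- The set {(n1, n2, q) ∈ ℤ² × ℤ⁺ : (n1, n2) ≠ (0, 0) and q·√(p1² + p2²) ≤ 2·β/ω} is finite. -/
/-- Positive integers `q` and nonzero integer pairs `(a, b)` with `q * |a|` and `q * |b|` bounded
form a finite set. -/
theorem finite_setOf_pos_mul_abs_le (N : ℤ) :
    {x : ℤ × ℤ × ℤ | 0 < x.2.2 ∧ (x.1, x.2.1) ≠ ((0 : ℤ), (0 : ℤ)) ∧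
      x.2.2 * |x.1| ≤ N ∧ x.2.2 * |x.2.1| ≤ N}.Finite := by
  refine ((Set.finite_Icc (-N) N).prod
    ((Set.finite_Icc (-N) N).prod (Set.finite_Icc (-N) N))).subset ?_
  rintro ⟨a, b, q⟩ ⟨hq, hab, ha, hb⟩
  dsimp only at hq hab ha hb
  have ha' : |a| ≤ N := by nlinarith [abs_nonneg a]
  have hb' : |b| ≤ N := by nlinarith [abs_nonneg b]
  have hqN : q ≤ N := by
    by_cases h : a = 0
    · have : 0 < |b| := abs_pos.mpr fun hb0 => hab (by rw [h, hb0])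
      nlinarith
    · have : 0 < |a| := abs_pos.mpr h
      nlinarith
  exact ⟨abs_le.mp ha', abs_le.mp hb', by dsimp only; linarith, hqN⟩

/-- If `c * n = t * u + v` with `c > 0`, `t ≥ 0`, `|u| ≤ s`, `|v| ≤ s` and `q * s ≤ C`, then
`q * |n| ≤ (t + 1) * C / c`. -/
theorem mul_abs_le_of_mul_eq_add {c t u v s q C n : ℝ} (hc : 0 < c) (ht : 0 ≤ t) (hq : 0 ≤ q)
    (hu : |u| ≤ s) (hv : |v| ≤ s) (hs : q * s ≤ C) (h : c * n = t * u + v) :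
    q * |n| ≤ (t + 1) * C / c := by
  rw [le_div_iff₀ hc]
  have hn : c * |n| ≤ (t + 1) * s := by
    calc c * |n| = |t * u + v| := by rw [← h, abs_mul, abs_of_pos hc]
      _ ≤ t * |u| + |v| := by simpa [abs_mul, abs_of_nonneg ht] using abs_add_le (t * u) v
      _ ≤ t * s + s := by gcongr
      _ = (t + 1) * s := by ring
  calc q * |n| * c = q * (c * |n|) := by ring
    _ ≤ q * ((t + 1) * s) := by gcongr
    _ = (t + 1) * (q * s) := by ring
    _ ≤ (t + 1) * C := by gcongr

/-- The set `{(n1, n2, q) ∈ ℤ² × ℤ⁺ : (n1, n2) ≠ (0, 0) and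
q·√(p1² + p2²) ≤ 2·β/ω}` is finite, where `p1 = k1·n1 + k2·n2` and
`p2 = τ1·k1·n1 − τ2·k2·n2`. -/
theorem stmt_11 (ω β k1 k2 τ1 τ2 : ℝ) (hω : 0 < ω) (hβ : 0 < β)
    (hk1 : 0 < k1) (hk2 : 0 < k2) (hτ1 : 0 < τ1) (hτ2 : 0 < τ2) :
    {x : ℤ × ℤ × ℤ | 0 < x.2.2 ∧ (x.1, x.2.1) ≠ ((0 : ℤ), (0 : ℤ)) ∧
      (x.2.2 : ℝ) * Real.sqrt ((k1 * x.1 + k2 * x.2.1) ^ 2 +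
          (τ1 * k1 * x.1 - τ2 * k2 * x.2.1) ^ 2) ≤ 2 * β / ω}.Finite := by
  set A := (τ2 + 1) * (2 * β / ω) / ((τ1 + τ2) * k1)
  set B := (τ1 + 1) * (2 * β / ω) / ((τ1 + τ2) * k2)
  refine (finite_setOf_pos_mul_abs_le ⌊max A B⌋).subset ?_
  rintro ⟨a, b, q⟩ ⟨hq, hab, h⟩
  dsimp only at hq hab h
  have hq' : (0 : ℝ) ≤ q := by exact_mod_cast hq.le
  set u := k1 * (a : ℝ) + k2 * b with hu
  set v := τ1 * k1 * (a : ℝ) - τ2 * k2 * b with hv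
  have hus : |u| ≤ √(u ^ 2 + v ^ 2) := Real.abs_le_sqrt (by nlinarith [sq_nonneg v])
  have hvs : |v| ≤ √(u ^ 2 + v ^ 2) := Real.abs_le_sqrt (by nlinarith [sq_nonneg u])
  have ha : q * |(a : ℝ)| ≤ A :=
    mul_abs_le_of_mul_eq_add (by positivity) hτ2.le hq' hus hvs h (by rw [hu, hv]; ring)
  have hb : q * |(b : ℝ)| ≤ B :=
    mul_abs_le_of_mul_eq_add (v := -v) (by positivity) hτ1.le hq' hus (by rwa [abs_neg]) h
      (by rw [hu, hv]; ring)
  refine ⟨hq, hab, Int.le_floor.mpr ?_, Int.le_floor.mpr ?_⟩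
  · push_cast
    exact ha.trans (le_max_left A B)
  · push_cast
    exact hb.trans (le_max_right A B)
end

section
/- Suppose p ≠ (0, 0) and q·(1 + ω·|p|²) = β·|p| (so that Δ = 0). If there exists (η, v) ∈ ℂ × ℂ² satisfying −q·(1 + ω·|p|²)·η + i·β·(p·v) = i·(p·f) and i·β·η·p + q·(1 + ω·|p|²)·v = i·g·p, then the compatibility condition |p|·g + i·(p·f) = 0 holds. -/
/-- Suppose `p ≠ (0, 0)` and `q·(1 + ω·|p|²) = β·|p|` (so that `Δ = 0`).
If there exists `(η, v) ∈ ℂ × ℂ²` satisfying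
`−q·(1 + ω·|p|²)·η + i·β·(p·v) = i·(p·f)` and
`i·β·η·p + q·(1 + ω·|p|²)·v = i·g·p`, then the compatibility condition
`|p|·g + i·(p·f) = 0` holds. -/
theorem stmt_15 (ω β q : ℝ) (hω : 0 < ω) (hβ : 0 < β) (hq : 0 < q)
    (p1 p2 : ℝ) (g f1 f2 : ℂ)
    (hp : (p1, p2) ≠ ((0 : ℝ), (0 : ℝ)))
    (hres : q * (1 + ω * (p1 ^ 2 + p2 ^ 2)) = β * Real.sqrt (p1 ^ 2 + p2 ^ 2))
    (hsol : ∃ η v1 v2 : ℂ,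
      -(q : ℂ) * (1 + (ω : ℂ) * ((p1 ^ 2 + p2 ^ 2 : ℝ) : ℂ)) * η +
          Complex.I * (β : ℂ) * ((p1 : ℂ) * v1 + (p2 : ℂ) * v2) =
        Complex.I * ((p1 : ℂ) * f1 + (p2 : ℂ) * f2) ∧
      Complex.I * (β : ℂ) * η * (p1 : ℂ) +
          (q : ℂ) * (1 + (ω : ℂ) * ((p1 ^ 2 + p2 ^ 2 : ℝ) : ℂ)) * v1 =
        Complex.I * g * (p1 : ℂ) ∧
      Complex.I * (β : ℂ) * η * (p2 : ℂ) +
          (q : ℂ) * (1 + (ω : ℂ) * ((p1 ^ 2 + p2 ^ 2 : ℝ) : ℂ)) * v2 =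
        Complex.I * g * (p2 : ℂ)) :
    ((Real.sqrt (p1 ^ 2 + p2 ^ 2) : ℝ) : ℂ) * g +
      Complex.I * ((p1 : ℂ) * f1 + (p2 : ℂ) * f2) = 0 := by
  obtain ⟨η, v1, v2, e1, e2, e3⟩ := hsol
  have hpos : 0 < p1 ^ 2 + p2 ^ 2 := by
    by_contra! h
    have h1 : p1 = 0 := by nlinarith [sq_nonneg p1, sq_nonneg p2]
    have h2 : p2 = 0 := by nlinarith [sq_nonneg p1, sq_nonneg p2]
    exact hp (by rw [h1, h2])
  have hs0 : ((Real.sqrt (p1 ^ 2 + p2 ^ 2) : ℝ) : ℂ) ≠ 0 :=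
    Complex.ofReal_ne_zero.mpr (Real.sqrt_pos.mpr hpos).ne'
  have hs : ((Real.sqrt (p1 ^ 2 + p2 ^ 2) : ℝ) : ℂ) ^ 2 = (p1 : ℂ) ^ 2 + (p2 : ℂ) ^ 2 := by
    exact_mod_cast Real.sq_sqrt hpos.le
  have hA : (q : ℂ) * (1 + (ω : ℂ) * ((p1 ^ 2 + p2 ^ 2 : ℝ) : ℂ)) =
      (β : ℂ) * ((Real.sqrt (p1 ^ 2 + p2 ^ 2) : ℝ) : ℂ) := by
    exact_mod_cast hres
  generalize ((Real.sqrt (p1 ^ 2 + p2 ^ 2) : ℝ) : ℂ) = s at *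
  refine (mul_eq_zero.mp ?_).resolve_left hs0
  linear_combination (-s) * e1 + Complex.I * (p1 * e2 + p2 * e3)
    - (s * η + Complex.I * (p1 * v1 + p2 * v2)) * hA + (g - β * η) * hs
    - (β * η - g) * ((p1 : ℂ) ^ 2 + (p2 : ℂ) ^ 2) * Complex.I_sq
end

section
/- Suppose p ≠ (0, 0), q·(1 + ω·|p|²) = β·|p|, and the compatibility condition |p|·g + i·(p·f) = 0 holds. Then (η, v) ∈ ℂ × ℂ² satisfies −q·(1 + ω·|p|²)·η + i·β·(p·v) = i·(p·f) and i·β·η·p + q·(1 + ω·|p|²)·v = i·g·p if and only if there exists c ∈ ℂ such that η = c·|p| + g/β and v = −i·c·p. -/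
/-- Suppose `p ≠ (0, 0)`, `q·(1 + ω·|p|²) = β·|p|`, and the compatibility
condition `|p|·g + i·(p·f) = 0` holds. Then `(η, v) ∈ ℂ × ℂ²` satisfies
`−q·(1 + ω·|p|²)·η + i·β·(p·v) = i·(p·f)` and
`i·β·η·p + q·(1 + ω·|p|²)·v = i·g·p` if and only if there exists `c ∈ ℂ` such
that `η = c·|p| + g/β` and `v = −i·c·p`. -/
theorem stmt_16 (ω β q : ℝ) (hω : 0 < ω) (hβ : 0 < β) (hq : 0 < q)
    (p1 p2 : ℝ) (g f1 f2 : ℂ)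
    (hp : (p1, p2) ≠ ((0 : ℝ), (0 : ℝ)))
    (hres : q * (1 + ω * (p1 ^ 2 + p2 ^ 2)) = β * Real.sqrt (p1 ^ 2 + p2 ^ 2))
    (hcomp : ((Real.sqrt (p1 ^ 2 + p2 ^ 2) : ℝ) : ℂ) * g +
      Complex.I * ((p1 : ℂ) * f1 + (p2 : ℂ) * f2) = 0)
    (η v1 v2 : ℂ) :
    (-(q : ℂ) * (1 + (ω : ℂ) * ((p1 ^ 2 + p2 ^ 2 : ℝ) : ℂ)) * η +
          Complex.I * (β : ℂ) * ((p1 : ℂ) * v1 + (p2 : ℂ) * v2) =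
        Complex.I * ((p1 : ℂ) * f1 + (p2 : ℂ) * f2) ∧
      Complex.I * (β : ℂ) * η * (p1 : ℂ) +
          (q : ℂ) * (1 + (ω : ℂ) * ((p1 ^ 2 + p2 ^ 2 : ℝ) : ℂ)) * v1 =
        Complex.I * g * (p1 : ℂ) ∧
      Complex.I * (β : ℂ) * η * (p2 : ℂ) +
          (q : ℂ) * (1 + (ω : ℂ) * ((p1 ^ 2 + p2 ^ 2 : ℝ) : ℂ)) * v2 =
        Complex.I * g * (p2 : ℂ)) ↔
    (∃ c : ℂ, η = c * ((Real.sqrt (p1 ^ 2 + p2 ^ 2) : ℝ) : ℂ) + g / (β : ℂ) ∧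
      v1 = -Complex.I * c * (p1 : ℂ) ∧ v2 = -Complex.I * c * (p2 : ℂ)) := by
  have hs_nonneg : 0 ≤ p1 ^ 2 + p2 ^ 2 := by positivity
  have hs_ne : p1 ^ 2 + p2 ^ 2 ≠ 0 := by
    intro h
    apply hp
    have h1 : p1 = 0 := by nlinarith [sq_nonneg p1, sq_nonneg p2]
    have h2 : p2 = 0 := by nlinarith [sq_nonneg p1, sq_nonneg p2]
    rw [h1, h2]
  have hr_ne : Real.sqrt (p1 ^ 2 + p2 ^ 2) ≠ 0 := by
    rwa [Ne, Real.sqrt_eq_zero hs_nonneg]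
  have hsq := Real.sq_sqrt hs_nonneg
  generalize Real.sqrt (p1 ^ 2 + p2 ^ 2) = r at *
  have hK : (q : ℂ) * (1 + (ω : ℂ) * ((p1 ^ 2 + p2 ^ 2 : ℝ) : ℂ)) = (β : ℂ) * (r : ℂ) := by
    exact_mod_cast congrArg (fun x : ℝ => (x : ℂ)) hres
  have hsqC : (r : ℂ) ^ 2 = (p1 : ℂ) ^ 2 + (p2 : ℂ) ^ 2 := by exact_mod_cast hsq
  have hr : (r : ℂ) ≠ 0 := by exact_mod_cast hr_ne
  have hb : (β : ℂ) ≠ 0 := by exact_mod_cast hβ.ne'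
  rw [neg_mul (q : ℂ), hK]
  constructor
  · rintro ⟨-, h1, h2⟩
    refine ⟨(η - g / β) / r, ?_, ?_, ?_⟩
    · field_simp
      ring
    · field_simp
      linear_combination h1
    · field_simp
      linear_combination h2
  · rintro ⟨c, rfl, rfl, rfl⟩
    have hg : (β : ℂ) * (g / β) = g := mul_div_cancel₀ g hb
    refine ⟨?_, ?_, ?_⟩
    · linear_combination (-(r : ℂ)) * hg - hcomp - β * c * hsqC
        - β * c * ((p1 : ℂ) ^ 2 + (p2 : ℂ) ^ 2) * Complex.I_sq
    · linear_combination Complex.I * p1 * hg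
    · linear_combination Complex.I * p2 * hg
end
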